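/- Let V be a finite type, E : V → V → Prop a directed graph relation, and Ext : Set V a set of 'external' vertices. Assume (a) acyclicity: for every v, ¬ Relation.TransGen E v v; and (b) balance at internal vertices: for every v ∉ Ext, (∃ u, E u v) ↔ (∃ w, E v w). Then for all a b with E a b there exist external vertices x, y ∈ Ext with x ≠ y, both joined to a by the reflexive-transitive closure of the symmetrized relation (fun u v => E u v ∨ E v u), such that Relation.TransGen E x y, i.e. x is trajected to y by a directed path. (Extension of Proposition 3: each I-connected component containing an edge contains two external vertices v₁ and v₂ such that v₁ is I-trajected to v₂.) -/

import Mathlib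

/-- In a finite acyclic directed graph in which every vertex outside `S` with an incoming edge has
an outgoing edge, every vertex with an incoming edge reaches `S`. -/
theorem exists_mem_reflTransGen_of_acyclic {V : Type*} [Finite V] {E : V → V → Prop} {S : Set V}
    (hacyc : ∀ v, ¬ Relation.TransGen E v v)
    (hout : ∀ v, v ∉ S → (∃ u, E u v) → ∃ w, E v w) {v : V} (hv : ∃ u, E u v) :
    ∃ y ∈ S, Relation.ReflTransGen E v y := by
  have : IsTrans V (Function.swap (Relation.TransGen E)) := ⟨fun _ _ _ h₁ h₂ => h₂.trans h₁⟩
  have : Std.Irrefl (Function.swap (Relation.TransGen E)) := ⟨hacyc⟩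
  have hwf := Finite.wellFounded_of_trans_of_irrefl (Function.swap (Relation.TransGen E))
  induction v using hwf.induction with
  | _ v ih =>
    by_cases hS : v ∈ S
    · exact ⟨v, hS, .refl⟩
    · obtain ⟨w, hw⟩ := hout v hS hv
      obtain ⟨y, hy, hwy⟩ := ih w (.single hw) ⟨v, hw⟩
      exact ⟨y, hy, .head hw hwy⟩

/-- Extension of Proposition 3: each I-connected component containing an
edge contains two external vertices `x ≠ y` such that `x` is I-trajected
to `y`. -/
theorem component_contains_trajected_external_vertices
    {V : Type*} [Fintype V] (E : V → V → Prop) (Ext : Set V)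
    (hacyc : ∀ v : V, ¬ Relation.TransGen E v v)
    (hbal : ∀ v : V, v ∉ Ext → ((∃ u, E u v) ↔ (∃ w, E v w))) :
    ∀ a b : V, E a b →
      ∃ x ∈ Ext, ∃ y ∈ Ext, x ≠ y ∧
        Relation.ReflTransGen (fun u v => E u v ∨ E v u) x a ∧
        Relation.ReflTransGen (fun u v => E u v ∨ E v u) y a ∧
        Relation.TransGen E x y := by
  intro a b hab
  obtain ⟨y, hy, hby⟩ :=
    exists_mem_reflTransGen_of_acyclic hacyc (fun v hv => (hbal v hv).1) ⟨a, hab⟩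
  obtain ⟨x, hx, hax⟩ := exists_mem_reflTransGen_of_acyclic (E := Function.swap E)
    (fun v h => hacyc v (Relation.transGen_swap.1 h)) (fun v hv => (hbal v hv).2) ⟨b, hab⟩
  have hxa : Relation.ReflTransGen E x a := Relation.reflTransGen_swap.1 hax
  have hxy : Relation.TransGen E x y := (Relation.TransGen.tail' hxa hab).trans_left hby
  refine ⟨x, hx, y, hy, ?_, Relation.ReflTransGen.mono (fun _ _ => Or.inl) _ _ hxa, ?_, hxy⟩
  · rintro rfl
    exact hacyc x hxy
  · exact Relation.ReflTransGen.mono (fun _ _ => Or.inr) _ _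
      (Relation.reflTransGen_swap.2 (.head hab hby))
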